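/- arXiv:math/0610103 — 3 statements merged into one kernel-verified Lean document; each statement's English description precedes it below -/
import Mathlib

section
/- Let {(d_i, n_i, c_i) : i ∈ I} be a polyhedral ESP satisfying the set-B condition. Then for every nonempty subset C ⊆ I and every d ∈ L_C with d ≠ 0, where L_C = {−Σ_{i∈C} a_i d_i : a_i ≥ 0 for i ∈ C}, one has min_{i∈C} ⟨n_i, d⟩ < 0. -/
open Set MeasureTheory Filter
open scoped RealInnerProductSpace

noncomputable section

abbrev EuclJ (J : ℕ) := EuclideanSpace ℝ (Fin J)

/-- A path `f : ℝ → ℝ^J` (viewed on `[0,∞)`) is càdlàg: right-continuous at every `t ≥ 0`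
and with (finite) left limits at every `t > 0`. -/
def Cadlag {J : ℕ} (f : ℝ → EuclJ J) : Prop :=
  (∀ t : ℝ, 0 ≤ t → ContinuousWithinAt f (Ici t) t) ∧
  (∀ t : ℝ, 0 < t → ∃ L : EuclJ J, Tendsto f (nhdsWithin t (Iio t)) (nhds L))

/-- The standing assumptions on the data `(G, d(·))`. -/
structure StandingAssumptions {J : ℕ} (G : Set (EuclJ J))
    (d : EuclJ J → Set (EuclJ J)) : Prop where
  domain : ∃ U : Set (EuclJ J), IsOpen U ∧ U.Nonempty ∧ IsConnected U ∧ G = closure U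
  isClosed_dir : ∀ x ∈ frontier G, IsClosed (d x)
  convex_dir : ∀ x ∈ frontier G, Convex ℝ (d x)
  cone_dir : ∀ x ∈ frontier G, ∀ v ∈ d x, ∀ a : ℝ, 0 ≤ a → a • v ∈ d x
  nonzero_dir : ∀ x ∈ frontier G, ∃ v ∈ d x, v ≠ 0
  eq_zero_dir : ∀ x, x ∉ frontier G → d x = {0}
  closed_graph : IsClosed {p : EuclJ J × EuclJ J | p.1 ∈ G ∧ p.2 ∈ d p.1}

/-- `(φ, η)` solves the Extended Skorokhod Problem for `ψ` (with data `(G, d(·))`). -/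
def SolvesESP {J : ℕ} (G : Set (EuclJ J)) (d : EuclJ J → Set (EuclJ J))
    (ψ φ η : ℝ → EuclJ J) : Prop :=
  Cadlag φ ∧ Cadlag η ∧ φ 0 = ψ 0 ∧
  (∀ t : ℝ, 0 ≤ t → φ t = ψ t + η t) ∧
  (∀ t : ℝ, 0 ≤ t → φ t ∈ G) ∧
  (∀ s t : ℝ, 0 ≤ s → s ≤ t →
      η t - η s ∈ closure (convexHull ℝ (⋃ u ∈ Ioc s t, d (φ u)))) ∧
  (∀ t : ℝ, 0 < t → η t - Function.leftLim η t ∈ closure (convexHull ℝ (d (φ t))))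

/-- The polyhedral domain `G = ⋂ i {x : ⟪x, nᵢ⟫ ≥ cᵢ}`. -/
def polyG {J I : ℕ} (n : Fin I → EuclJ J) (c : Fin I → ℝ) : Set (EuclJ J) :=
  ⋂ i, {x : EuclJ J | c i ≤ ⟪x, n i⟫}

/-- The active index set `I(x) = {i : ⟪x, nᵢ⟫ = cᵢ}`. -/
def polyIdx {J I : ℕ} (n : Fin I → EuclJ J) (c : Fin I → ℝ) (x : EuclJ J) : Set (Fin I) :=
  {i | ⟪x, n i⟫ = c i}

/-- The piecewise constant reflection field of a polyhedral ESP: for boundary points the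
cone generated by the `dᵢ` with `i ∈ I(x)`, and `{0}` elsewhere. -/
def polyDir {J I : ℕ} (dv n : Fin I → EuclJ J) (c : Fin I → ℝ) (x : EuclJ J) :
    Set (EuclJ J) :=
  {v | (x ∈ frontier (polyG n c) ∧
        ∃ a : Fin I → ℝ, (∀ i, 0 ≤ a i) ∧ (∀ i, i ∉ polyIdx n c x → a i = 0) ∧
          v = ∑ i, a i • dv i) ∨
       (x ∉ frontier (polyG n c) ∧ v = 0)}

/-- The set-B condition for the polyhedral ESP `{(dᵢ, nᵢ, cᵢ)}`. -/
def SetBCondition {J I : ℕ} (dv n : Fin I → EuclJ J) : Prop :=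
  ∃ B : Set (EuclJ J), IsCompact B ∧ Convex ℝ B ∧ B = -B ∧ (0 : EuclJ J) ∈ interior B ∧
    ∃ δ : ℝ, 0 < δ ∧ ∀ i : Fin I, ∀ z ∈ frontier B, |⟪z, n i⟫| < δ →
      ∀ ν : EuclJ J, ‖ν‖ = 1 → (∀ x ∈ B, 0 ≤ ⟪ν, x - z⟫) → ⟪ν, dv i⟫ = 0

/-- Every ray from an interior point `0` of a compact convex set `B` meets the frontier of `B`
at a point with an inward unit normal, which has negative inner product with the direction. -/
lemma exists_frontier_normal_of_ne_zero {J : ℕ} {B : Set (EuclJ J)} (hBc : IsCompact B)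
    (hBconv : Convex ℝ B) (hB0 : (0 : EuclJ J) ∈ interior B) {w : EuclJ J} (hw : w ≠ 0) :
    ∃ t : ℝ, 0 < t ∧ (w ∉ B → t < 1) ∧ t • w ∈ frontier B ∧
      ∃ ν : EuclJ J, ‖ν‖ = 1 ∧ (∀ x ∈ B, 0 ≤ ⟪ν, x - t • w⟫) ∧ ⟪ν, w⟫ < 0 := by
  have hnhds : B ∈ nhds (0 : EuclJ J) := mem_interior_iff_mem_nhds.mp hB0
  have hg : 0 < gauge B w :=
    (gauge_pos (absorbent_nhds_zero hnhds)
      ((NormedSpace.isVonNBounded_iff ℝ).2 hBc.isBounded)).2 hw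
  have ht : 0 < (gauge B w)⁻¹ := inv_pos.2 hg
  have hfr : (gauge B w)⁻¹ • w ∈ frontier B := by
    rw [← gauge_eq_one_iff_mem_frontier hBconv hnhds, gauge_smul_of_nonneg ht.le, smul_eq_mul,
      inv_mul_cancel₀ hg.ne']
  refine ⟨(gauge B w)⁻¹, ht, fun hwB => ?_, hfr, ?_⟩
  · refine inv_lt_one_of_one_lt₀ (not_le.1 fun hle => hwB ?_)
    rwa [gauge_le_one_iff_mem_closure hBconv hnhds, hBc.isClosed.closure_eq] at hle
  · set z := (gauge B w)⁻¹ • w with hz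
    obtain ⟨f, hf⟩ := geometric_hahn_banach_open_point hBconv.interior isOpen_interior hfr.2
    obtain ⟨v, rfl⟩ := (InnerProductSpace.toDual ℝ (EuclJ J)).surjective f
    simp only [InnerProductSpace.toDual_apply_apply] at hf
    have hle : ∀ x ∈ B, ⟪v, x⟫ ≤ ⟪v, z⟫ := by
      intro x hx
      have hx' : x ∈ closure (interior B) := by
        rw [hBconv.closure_interior_eq_closure_of_nonempty_interior ⟨0, hB0⟩]
        exact subset_closure hx
      exact le_on_closure (fun y hy => (hf y hy).le) (by fun_prop) (by fun_prop) hx'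
    have hvw : 0 < ⟪v, w⟫ := by
      have h0 := hf 0 hB0
      rw [inner_zero_right, hz, real_inner_smul_right] at h0
      exact pos_of_mul_pos_right h0 ht.le
    have hv : 0 < ‖v‖ := norm_pos_iff.2 fun h => by simp [h] at hvw
    refine ⟨-(‖v‖⁻¹ • v), ?_, fun x hx => ?_, ?_⟩
    · rw [norm_neg, norm_smul, norm_inv, norm_norm, inv_mul_cancel₀ hv.ne']
    · rw [inner_neg_left, real_inner_smul_left, inner_sub_right, ← mul_neg, neg_sub]
      exact mul_nonneg (inv_pos.2 hv).le (sub_nonneg.2 (hle x hx))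
    · rw [inner_neg_left, real_inner_smul_left]
      exact neg_neg_of_pos (mul_pos (inv_pos.2 hv) hvw)

/-- If every inward normal at a frontier point of `B` in the hyperplane `n⊥` is orthogonal to
`e`, then the projection onto `n⊥` along `e` maps `B` to itself. -/
lemma oblique_projection_mem {J : ℕ} {B : Set (EuclJ J)} (hBc : IsCompact B)
    (hBconv : Convex ℝ B) (hB0 : (0 : EuclJ J) ∈ interior B) {e n : EuclJ J}
    (hen : ⟪e, n⟫ = (1 : ℝ))
    (h : ∀ z ∈ frontier B, ⟪z, n⟫ = (0 : ℝ) →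
      ∀ ν : EuclJ J, ‖ν‖ = 1 → (∀ x ∈ B, 0 ≤ ⟪ν, x - z⟫) → ⟪ν, e⟫ = (0 : ℝ))
    {z : EuclJ J} (hz : z ∈ B) : z - (⟪z, n⟫ : ℝ) • e ∈ B := by
  by_contra hy
  have hy0 : z - (⟪z, n⟫ : ℝ) • e ≠ 0 := fun h0 => hy (h0 ▸ interior_subset hB0)
  obtain ⟨t, -, ht1, hfr, ν, hν, hνB, hνy⟩ :=
    exists_frontier_normal_of_ne_zero hBc hBconv hB0 hy0
  have hort : ⟪ν, e⟫ = (0 : ℝ) := by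
    refine h _ hfr ?_ ν hν hνB
    rw [real_inner_smul_left, inner_sub_left, real_inner_smul_left, hen]
    ring
  have hzν := hνB z hz
  simp only [inner_sub_right, real_inner_smul_right, hort] at hzν hνy
  nlinarith [ht1 hy]

/-- Under the set-B condition, for every nonempty `C ⊆ I` and every nonzero
`d ∈ L_C = {−Σ_{i∈C} aᵢ dᵢ : aᵢ ≥ 0}`, one has `min_{i∈C} ⟪nᵢ, d⟫ < 0`, i.e. there is
`i ∈ C` with `⟪nᵢ, d⟫ < 0`. -/
theorem setB_cone_min_neg {J I : ℕ} (dv n : Fin I → EuclJ J) (c : Fin I → ℝ)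
    (hn : ∀ i, ‖n i‖ = 1) (hdn : ∀ i, ⟪dv i, n i⟫ = 1)
    (hG : (interior (polyG n c)).Nonempty)
    (hB : SetBCondition dv n)
    (C : Finset (Fin I)) (hC : C.Nonempty)
    (a : Fin I → ℝ) (ha : ∀ i, 0 ≤ a i)
    (w : EuclJ J) (hw : w = -∑ i ∈ C, a i • dv i) (hw0 : w ≠ 0) :
    ∃ i ∈ C, ⟪n i, w⟫ < 0 := by
  obtain ⟨B, hBc, hBconv, -, hB0, δ, hδ, hBn⟩ := hB
  by_contra! hcon
  obtain ⟨t, ht, -, hfr, ν, hν, hνB, hνw⟩ :=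
    exists_frontier_normal_of_ne_zero hBc hBconv hB0 hw0
  have hface : ∀ i, ∀ z ∈ frontier B, ⟪z, n i⟫ = (0 : ℝ) →
      ∀ μ : EuclJ J, ‖μ‖ = 1 → (∀ x ∈ B, 0 ≤ ⟪μ, x - z⟫) → ⟪μ, dv i⟫ = (0 : ℝ) :=
    fun i z hz hzn => hBn i z hz (by rwa [hzn, abs_zero])
  have hneg : ∀ i ∈ C, ⟪ν, dv i⟫ ≤ (0 : ℝ) := by
    intro i hi
    have hnn : 0 ≤ ⟪t • w, n i⟫ := by
      rw [real_inner_smul_left, real_inner_comm]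
      exact mul_nonneg ht.le (hcon i hi)
    rcases hnn.eq_or_lt with h0 | hpos
    · exact (hface i _ hfr h0.symm ν hν hνB).le
    · have hmem := hνB _ (oblique_projection_mem hBc hBconv hB0 (hdn i) (hface i)
        (hBc.isClosed.frontier_subset hfr))
      rw [sub_sub_cancel_left, inner_neg_right, real_inner_smul_right] at hmem
      nlinarith
  refine hνw.not_ge ?_
  rw [hw, inner_neg_right, inner_sum, neg_nonneg]
  refine Finset.sum_nonpos fun i hi => ?_
  rw [real_inner_smul_right]
  exact mul_nonpos_of_nonneg_of_nonpos (ha i) (hneg i hi)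
end
end

section
/- Let {(d_i, n_i, 0) : i ∈ I} be a polyhedral ESP (all c_i = 0, so G is a closed convex polyhedral cone with vertex at the origin) satisfying the set-B condition, with V-set equal to {0}, and whose domain has angle less than π in the sense that there exist a unit vector v and ζ > 0 with ζ|x| < ⟨x, v⟩ for every x ∈ G \ {0}. Then for every R < ∞ there exist L < ∞, θ > 0, r ∈ (0, R) and a function g : ℝ^J → ℝ that is twice continuously differentiable on an open set containing G \ {0}, such that: (1) g(x) = 0 whenever x ∈ G and |x| > R; (2) ⟨∇g(x), d⟩ ≥ 0 for every x ∈ ∂G \ {0} and every unit vector d ∈ d(x), and ⟨∇g(x), d⟩ ≥ θ for every x ∈ ∂G \ {0} with |x| ≤ r and every unit vector d ∈ d(x); (3) |g(x)| ≤ L and |∇g(x)| ≤ L for all x ∈ G, and Σ_{i,j=1}^J |∂²g(x)/∂x_i∂x_j| ≤ 2L/|x| for all x ∈ G \ {0} (i.e. the ESP satisfies the test-function assumption with exponent β = 1). -/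
open Set MeasureTheory Filter
open scoped RealInnerProductSpace

noncomputable section

/-- The `V`-set of the data `(G, d(·))`: boundary points at which `d(x)` contains a line. -/
def Vset {J : ℕ} (G : Set (EuclJ J)) (d : EuclJ J → Set (EuclJ J)) : Set (EuclJ J) :=
  {x ∈ frontier G | ∃ u : EuclJ J, ‖u‖ = 1 ∧ u ∈ d x ∧ -u ∈ d x}


section

variable {J I : ℕ}

/-- Translating along `d` inside the slab `|⟪·, n⟫| < δ` never leaves a set `B` all of whose
inward normals in that slab are orthogonal to `d`. -/
lemma add_smul_mem_of_normals_orthogonal {B : Set (EuclJ J)} (hBc : IsCompact B)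
    (hBconv : Convex ℝ B) (hB0 : (0 : EuclJ J) ∈ interior B) {δ : ℝ} {d n : EuclJ J}
    (hd : ∀ z ∈ frontier B, |⟪z, n⟫| < δ →
      ∀ ν : EuclJ J, ‖ν‖ = 1 → (∀ x ∈ B, 0 ≤ ⟪ν, x - z⟫) → ⟪ν, d⟫ = 0)
    {p : EuclJ J} {t : ℝ} (hp : p ∈ B) (hpn : |⟪p + t • d, n⟫| < δ) : p + t • d ∈ B := by
  by_contra hq
  set q := p + t • d with hq_def
  have hnhds : B ∈ nhds (0 : EuclJ J) := mem_interior_iff_mem_nhds.1 hB0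
  have hgauge : 1 < gauge B q := by
    by_contra! h
    rw [gauge_le_one_iff_mem_closure hBconv hnhds, hBc.isClosed.closure_eq] at h
    exact hq h
  set c := (gauge B q)⁻¹ with hc
  have hc0 : 0 < c := by positivity
  have hc1 : c < 1 := inv_lt_one_of_one_lt₀ hgauge
  have hz : c • q ∈ frontier B := by
    rw [← gauge_eq_one_iff_mem_frontier hBconv hnhds, gauge_smul_of_nonneg hc0.le, smul_eq_mul, hc]
    field_simp
  have hzn : |⟪c • q, n⟫| < δ := by
    rw [real_inner_smul_left, abs_mul, abs_of_pos hc0]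
    nlinarith [abs_nonneg ⟪q, n⟫]
  obtain ⟨f, hf⟩ := geometric_hahn_banach_open_point hBconv.interior isOpen_interior hz.2
  have hfB : ∀ x ∈ B, f x ≤ f (c • q) := by
    intro x hx
    have hx' : x ∈ closure (interior B) := by
      rw [hBconv.closure_interior_eq_closure_of_nonempty_interior ⟨0, hB0⟩]
      exact subset_closure hx
    exact closure_minimal (fun a ha => (hf a ha).le)
      (isClosed_le f.continuous continuous_const) hx'
  have hf0 : 0 < f (c • q) := by simpa using hf 0 hB0
  set w := (InnerProductSpace.toDual ℝ (EuclJ J)).symm f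
  have hwf : ∀ x, ⟪w, x⟫ = f x := fun x => InnerProductSpace.toDual_symm_apply
  have hw0 : 0 < ‖w‖ := by
    rw [norm_pos_iff]
    intro h
    rw [← hwf, h, inner_zero_left] at hf0
    exact hf0.false
  have hwd : f d = 0 := by
    have h := hd _ hz hzn (-‖w‖⁻¹ • w) (by rw [norm_smul]; simp [hw0.ne']) (fun x hx => by
      rw [real_inner_smul_left, hwf, map_sub]
      have := mul_nonneg (inv_pos.2 hw0).le (sub_nonneg.2 (hfB x hx))
      linarith)
    rw [real_inner_smul_left, hwf] at h
    simpa [hw0.ne'] using h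
  have hpq : f q = f p := by simp [hq_def, hwd]
  have h1 := hfB p hp
  rw [map_smul, smul_eq_mul] at h1 hf0
  have h2 : 0 < f q := pos_of_mul_pos_right hf0 hc0.le
  nlinarith

/-- Mollifying the indicator of the set `B` yields a bump function whose derivative in the
direction `dᵢ` vanishes on the hyperplane orthogonal to `nᵢ`. -/
lemma SetBCondition.exists_bump {dv n : Fin I → EuclJ J} (hn : ∀ i, ‖n i‖ = 1)
    (hdn : ∀ i, ⟪dv i, n i⟫ = 1) (hB : SetBCondition dv n) :
    ∃ χ : EuclJ J → ℝ, ContDiff ℝ 2 χ ∧ HasCompactSupport χ ∧ (∀ z, 0 ≤ χ z) ∧ 0 < χ 0 ∧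
      ∀ i z, ⟪z, n i⟫ = 0 → fderiv ℝ χ z (dv i) = 0 := by
  obtain ⟨B, hBc, hBconv, -, hB0, δ, hδ, hd⟩ := hB
  obtain ⟨ε, hε, hεB⟩ := Metric.mem_nhds_iff.1 (mem_interior_iff_mem_nhds.1 hB0)
  set η := min ε (δ / 2)
  have hη : 0 < η := lt_min hε (by linarith)
  let ρ : ContDiffBump (0 : EuclJ J) := ⟨η / 2, η, by linarith, by linarith⟩
  set k := B.indicator (fun _ => (1 : ℝ))
  have hk0 : ∀ x, 0 ≤ k x := fun x => indicator_nonneg (fun _ _ => zero_le_one) x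
  have hk1 : ∀ x ∈ B, k x = 1 := fun x hx => indicator_of_mem hx _
  have hk_out : ∀ x ∉ B, k x = 0 := fun x hx => indicator_of_notMem hx _
  have hksupp : HasCompactSupport k := HasCompactSupport.intro hBc fun x hx => hk_out x hx
  have hkint : Integrable k volume :=
    (integrable_indicator_iff hBc.measurableSet).2 (integrableOn_const hBc.measure_lt_top.ne)
  set L := ContinuousLinearMap.mul ℝ ℝ
  set χ := MeasureTheory.convolution (ρ.normed volume) k L volume
  have hval : ∀ z, χ z = ∫ t, ρ.normed volume t * k (z - t) := fun z => rfl
  have hsmooth : ContDiff ℝ 2 χ := by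
    have hρ : HasCompactSupport (ρ.normed volume) := ρ.hasCompactSupport_normed
    exact hρ.contDiff_convolution_left (n := 2) L ρ.contDiff_normed hkint.locallyIntegrable
  refine ⟨χ, hsmooth, ρ.hasCompactSupport_normed.convolution L hksupp, fun z => ?_, ?_, ?_⟩
  · rw [hval]
    exact integral_nonneg fun t => mul_nonneg (ρ.nonneg_normed t) (hk0 _)
  · have : χ 0 = 1 := by
      rw [hval, ← ρ.integral_normed (μ := (volume : Measure (EuclJ J)))]
      refine integral_congr_ae (ae_of_all _ fun t => ?_)
      by_cases ht : t ∈ Metric.ball (0 : EuclJ J) η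
      · have : 0 - t ∈ B := hεB (by
          simpa using lt_of_lt_of_le (mem_ball_zero_iff.1 ht) (min_le_left _ _))
        simp only [hk1 _ this, mul_one]
      · have : ρ.normed volume t = 0 := by
          rw [← Function.notMem_support, ρ.support_normed_eq]
          exact ht
        simp [this]
    rw [this]; exact one_pos
  · intro i z hz
    have hconst : ∀ s : ℝ, |s| < δ / 2 → χ (z + s • dv i) = χ z := by
      intro s hs
      rw [hval, hval]
      refine integral_congr_ae (ae_of_all _ fun t => ?_)
      by_cases ht : t ∈ Metric.ball (0 : EuclJ J) η
      · have htn : |⟪t, n i⟫| < δ / 2 := by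
          have h1 := abs_real_inner_le_norm t (n i)
          rw [hn, mul_one] at h1
          exact (h1.trans_lt (mem_ball_zero_iff.1 ht)).trans_le (min_le_right _ _)
        have htn' := abs_lt.1 htn
        have hs' := abs_lt.1 hs
        have hiff : z + s • dv i - t ∈ B ↔ z - t ∈ B := by
          constructor
          · intro h
            have h2 : z + s • dv i - t + (-s) • dv i = z - t := by rw [neg_smul]; abel
            rw [← h2]
            refine add_smul_mem_of_normals_orthogonal hBc hBconv hB0 (hd i) h ?_
            rw [h2, inner_sub_left, hz, abs_lt]
            constructor <;> linarith
          · intro h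
            have h2 : z - t + s • dv i = z + s • dv i - t := by abel
            rw [← h2]
            refine add_smul_mem_of_normals_orthogonal hBc hBconv hB0 (hd i) h ?_
            rw [inner_add_left, inner_sub_left, real_inner_smul_left, hz, hdn, abs_lt]
            constructor <;> linarith
        have : k (z + s • dv i - t) = k (z - t) := by
          by_cases h : z - t ∈ B
          · rw [hk1 _ h, hk1 _ (hiff.2 h)]
          · rw [hk_out _ h, hk_out _ (mt hiff.1 h)]
        simp only [this]
      · have : ρ.normed volume t = 0 := by
          rw [← Function.notMem_support, ρ.support_normed_eq]
          exact ht
        simp [this]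
    have hdiff : HasLineDerivAt ℝ χ (fderiv ℝ χ z (dv i)) z (dv i) :=
      (hsmooth.differentiable (by norm_num) z).hasFDerivAt.hasLineDerivAt _
    have hdiff' : HasLineDerivAt ℝ χ 0 z (dv i) := by
      refine (hasDerivAt_const (0 : ℝ) (χ z)).congr_of_eventuallyEq ?_
      filter_upwards [Metric.ball_mem_nhds (0 : ℝ) (half_pos hδ)] with s hs
      exact hconst s (by simpa using hs)
    exact hdiff.unique hdiff'

end

section

variable {J I : ℕ}

/-- Vectors generating a pointed cone lie in a common open half-space. -/
lemma exists_inner_pos_of_pointed (dv : Fin I → EuclJ J) (S : Set (Fin I))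
    (h : ∀ a : Fin I → ℝ, (∀ i, 0 ≤ a i) → (∀ i, i ∉ S → a i = 0) →
      ∑ i, a i • dv i = 0 → ∀ i, a i = 0) :
    ∃ q : EuclJ J, ∀ i ∈ S, 0 < ⟪q, dv i⟫ := by
  classical
  set T : Set (Fin I → ℝ) := stdSimplex ℝ (Fin I) ∩ ⋂ i ∈ Sᶜ, {a | a i = 0}
  have hTc : IsCompact T := (isCompact_stdSimplex ℝ (Fin I)).inter_right <|
    isClosed_biInter fun i _ => isClosed_eq (continuous_apply i) continuous_const
  have hTconv : Convex ℝ T := by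
    refine (convex_stdSimplex ℝ _).inter (convex_iInter₂ fun i _ => ?_)
    exact convex_hyperplane (f := fun a : Fin I → ℝ => a i) ⟨fun _ _ => rfl, fun _ _ => rfl⟩ 0
  set Λ := Fintype.linearCombination ℝ dv
  have hΛ : ∀ a, Λ a = ∑ i, a i • dv i := fun a => Fintype.linearCombination_apply ℝ dv a
  have h0 : (0 : EuclJ J) ∉ Λ '' T := by
    rintro ⟨a, ⟨⟨ha0, ha1⟩, haS⟩, ha⟩
    have := h a ha0 (fun i hi => mem_iInter₂.1 haS i hi) (by rw [← hΛ, ha])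
    simp [this] at ha1
  obtain ⟨f, u, hfu, hf⟩ := geometric_hahn_banach_point_closed (hTconv.linear_image Λ)
    (hTc.image Λ.continuous_of_finiteDimensional).isClosed h0
  refine ⟨(InnerProductSpace.toDual ℝ (EuclJ J)).symm f, fun i hi => ?_⟩
  rw [InnerProductSpace.toDual_symm_apply]
  rw [map_zero] at hfu
  refine hfu.trans (hf _ ⟨Pi.single i 1, ⟨single_mem_stdSimplex ℝ i, mem_iInter₂.2 ?_⟩, ?_⟩)
  · intro j hj
    exact Pi.single_eq_of_ne (by rintro rfl; exact hj hi) _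
  · simp [Λ]

/-- Outside of the `V`-set the active directions lie in a common open half-space. -/
lemma exists_inner_pos_of_notMem_Vset {dv n : Fin I → EuclJ J} {c : Fin I → ℝ}
    (hd0 : ∀ i, dv i ≠ 0) {x : EuclJ J} (hx : x ∈ frontier (polyG n c))
    (hxV : x ∉ Vset (polyG n c) (polyDir dv n c)) :
    ∃ q : EuclJ J, ∀ i ∈ polyIdx n c x, 0 < ⟪q, dv i⟫ := by
  classical
  refine exists_inner_pos_of_pointed dv _ fun a ha haS hsum j => ?_
  by_contra hj
  have haj : 0 < a j := lt_of_le_of_ne (ha j) (Ne.symm hj)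
  have hjS : j ∈ polyIdx n c x := by
    by_contra h
    exact hj (haS j h)
  have hdj : 0 < ‖dv j‖ := norm_pos_iff.2 (hd0 j)
  refine hxV ⟨hx, ‖dv j‖⁻¹ • dv j, ?_, Or.inl ⟨hx, Pi.single j ‖dv j‖⁻¹, ?_, ?_, ?_⟩,
    Or.inl ⟨hx, fun i => if i = j then 0 else ‖dv j‖⁻¹ * (a j)⁻¹ * a i, ?_, ?_, ?_⟩⟩
  · simp [norm_smul, hdj.ne']
  · intro i
    by_cases h : i = j
    · subst h; simp
    · simp [h]
  · intro i hi
    exact Pi.single_eq_of_ne (by rintro rfl; exact hi hjS) _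
  · simp [Pi.single_apply, ite_smul]
  · intro i
    have := ha i
    dsimp only
    split_ifs <;> positivity
  · intro i hi
    simp [haS i hi]
  · rw [← Finset.add_sum_erase _ _ (Finset.mem_univ j)] at hsum ⊢
    have h1 : ∀ i ∈ Finset.univ.erase j,
        (if i = j then 0 else ‖dv j‖⁻¹ * (a j)⁻¹ * a i) • dv i
          = (‖dv j‖⁻¹ * (a j)⁻¹) • (a i • dv i) := by
      intro i hi
      rw [if_neg (Finset.ne_of_mem_erase hi), mul_smul]
    rw [Finset.sum_congr rfl h1, ← Finset.smul_sum]
    beta_reduce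
    rw [if_pos rfl, zero_smul, zero_add,
      ← neg_eq_of_add_eq_zero_right hsum, smul_neg, smul_smul, mul_assoc,
      inv_mul_cancel₀ haj.ne', mul_one]

/-- The hyperplanes that a sufficiently small ball meets all pass through its center. -/
lemma eventually_inner_eq_zero_imp (n : Fin I → EuclJ J) (x : EuclJ J) :
    ∀ᶠ y in nhds x, ∀ i, ⟪y, n i⟫ = 0 → ⟪x, n i⟫ = 0 := by
  refine eventually_all.2 fun i => ?_
  by_cases h : ⟪x, n i⟫ = 0
  · exact Eventually.of_forall fun _ _ => h
  · have : ContinuousAt (fun y : EuclJ J => ⟪y, n i⟫) x := by fun_prop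
    filter_upwards [this.eventually_ne h] with y hy hy0 using absurd hy0 hy

/-- A local test function near `x`: supported in `ball x s`, and increasing in the active
directions, strictly so near `x`. -/
lemma exists_local_test_function {dv n : Fin I → EuclJ J} {χ : EuclJ J → ℝ}
    (hχ : ContDiff ℝ 2 χ) (hχc : HasCompactSupport χ) (hχ0 : ∀ z, 0 ≤ χ z) (hχpos : 0 < χ 0)
    (hχd : ∀ i z, ⟪z, n i⟫ = 0 → fderiv ℝ χ z (dv i) = 0)
    {x q : EuclJ J} (hq : ∀ i, ⟪x, n i⟫ = 0 → 0 < ⟪q, dv i⟫) {s : ℝ} (hs : 0 < s)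
    (hball : ∀ y ∈ Metric.ball x s, ∀ i, ⟪y, n i⟫ = 0 → ⟪x, n i⟫ = 0) :
    ∃ ψ : EuclJ J → ℝ, ContDiff ℝ 2 ψ ∧ (∀ y ∉ Metric.ball x s, ψ y = 0) ∧
      (∀ i y, ⟪y, n i⟫ = 0 → 0 ≤ fderiv ℝ ψ y (dv i)) ∧
      ∀ᶠ y in nhds x, ∀ i, ⟪y, n i⟫ = 0 → 0 < fderiv ℝ ψ y (dv i) := by
  obtain ⟨A, hA, hAsub⟩ := hχc.isBounded.subset_ball_lt 0 0
  set l := A / s with hl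
  have hl0 : 0 < l := by positivity
  have hout : ∀ y ∉ Metric.ball x s, l • (y - x) ∉ tsupport χ := by
    intro y hy h
    have h1 := mem_ball_zero_iff.1 (hAsub h)
    rw [norm_smul, Real.norm_of_nonneg hl0.le, hl] at h1
    rw [mem_ball_iff_norm, not_lt] at hy
    have h2 : A / s * s ≤ A / s * ‖y - x‖ := mul_le_mul_of_nonneg_left hy hl0.le
    rw [div_mul_cancel₀ _ hs.ne'] at h2
    linarith
  set ψ : EuclJ J → ℝ := fun y => χ (l • (y - x)) * Real.exp ⟪q, y - x⟫ with hψ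
  have hder : ∀ y w, fderiv ℝ ψ y w = χ (l • (y - x)) * (Real.exp ⟪q, y - x⟫ * ⟪q, w⟫)
      + Real.exp ⟪q, y - x⟫ * (l * fderiv ℝ χ (l • (y - x)) w) := by
    intro y w
    have h0 : HasFDerivAt (fun y : EuclJ J => y - x) (ContinuousLinearMap.id ℝ _) y :=
      (hasFDerivAt_id y).sub_const x
    have h1 : HasFDerivAt (fun y => χ (l • (y - x))) _ y :=
      (hχ.differentiable (by norm_num) _).hasFDerivAt.comp y (h0.const_smul l)
    have h2 : HasFDerivAt (fun y => Real.exp ⟪q, y - x⟫) _ y :=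
      ((innerSL ℝ q).hasFDerivAt.comp y h0).exp
    have h3 : HasFDerivAt ψ _ y := h1.mul h2
    rw [h3.fderiv]
    simp
  have hact : ∀ i y, ⟪y, n i⟫ = 0 → fderiv ℝ ψ y (dv i) =
      χ (l • (y - x)) * (Real.exp ⟪q, y - x⟫ * ⟪q, dv i⟫) := by
    intro i y hy
    rw [hder]
    by_cases hyb : y ∈ Metric.ball x s
    · rw [hχd i (l • (y - x)) (by
        rw [real_inner_smul_left, inner_sub_left, hy, hball y hyb i hy]; simp)]
      simp
    · rw [fderiv_of_notMem_tsupport ℝ (hout y hyb)]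
      simp
  refine ⟨ψ, ?_, fun y hy => ?_, fun i y hy => ?_, ?_⟩
  · refine (hχ.comp (by fun_prop)).mul (Real.contDiff_exp.comp ?_)
    exact (innerSL ℝ q).contDiff.comp (contDiff_id.sub contDiff_const)
  · simp [hψ, image_eq_zero_of_notMem_tsupport (hout y hy)]
  · rw [hact i y hy]
    by_cases hyb : y ∈ Metric.ball x s
    · exact mul_nonneg (hχ0 _) (mul_nonneg (Real.exp_nonneg _) (hq i (hball y hyb i hy)).le)
    · simp [image_eq_zero_of_notMem_tsupport (hout y hyb)]
  · have hcont : ContinuousAt (fun y => χ (l • (y - x))) x :=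
      (hχ.continuous.comp (by fun_prop)).continuousAt
    have hpos : ∀ᶠ y in nhds x, 0 < χ (l • (y - x)) :=
      hcont.eventually (lt_mem_nhds (by simpa using hχpos))
    filter_upwards [hpos, Metric.ball_mem_nhds x hs] with y hy hyb i hyi
    rw [hact i y hyi]
    have := hq i (hball y hyb i hyi)
    positivity

/-- Patching of local test functions over a compact set `K` inside an open set `O`. -/
lemma exists_test_function_of_compact {dv n : Fin I → EuclJ J} {K O : Set (EuclJ J)}
    (hK : IsCompact K)
    (hloc : ∀ x ∈ K, ∃ ψ : EuclJ J → ℝ, ContDiff ℝ 2 ψ ∧ (∀ y ∉ O, ψ y = 0) ∧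
      (∀ i y, ⟪y, n i⟫ = 0 → 0 ≤ fderiv ℝ ψ y (dv i)) ∧
      ∀ᶠ y in nhds x, ∀ i, ⟪y, n i⟫ = 0 → 0 < fderiv ℝ ψ y (dv i)) :
    ∃ ψ : EuclJ J → ℝ, ContDiff ℝ 2 ψ ∧ (∀ y ∉ O, ψ y = 0) ∧
      (∀ i y, ⟪y, n i⟫ = 0 → 0 ≤ fderiv ℝ ψ y (dv i)) ∧
      ∃ θ > 0, ∀ i, ∀ y ∈ K, ⟪y, n i⟫ = 0 → θ ≤ fderiv ℝ ψ y (dv i) := by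
  classical
  choose! Ψ hΨ hΨO hΨ0 hΨpos using hloc
  obtain ⟨t, htK, hcover⟩ := hK.elim_nhds_subcover _ hΨpos
  have hder : ∀ y w, fderiv ℝ (fun y => ∑ x ∈ t, Ψ x y) y w = ∑ x ∈ t, fderiv ℝ (Ψ x) y w := by
    intro y w
    rw [fderiv_fun_sum fun x hx => (hΨ x (htK x hx)).differentiable (by norm_num) y]
    simp
  have hsmooth : ContDiff ℝ 2 (fun y => ∑ x ∈ t, Ψ x y) :=
    ContDiff.sum fun x hx => hΨ x (htK x hx)
  refine ⟨fun y => ∑ x ∈ t, Ψ x y, hsmooth,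
    fun y hy => Finset.sum_eq_zero fun x hx => hΨO x (htK x hx) y hy, fun i y hy => ?_, ?_⟩
  · rw [hder]
    exact Finset.sum_nonneg fun x hx => hΨ0 x (htK x hx) i y hy
  have hpos : ∀ i, ∀ y ∈ K, ⟪y, n i⟫ = 0 → 0 < fderiv ℝ (fun y => ∑ x ∈ t, Ψ x y) y (dv i) := by
    intro i y hyK hy
    obtain ⟨x, hx, hyx⟩ := mem_iUnion₂.1 (hcover hyK)
    rw [hder]
    exact Finset.sum_pos' (fun x hx => hΨ0 x (htK x hx) i y hy) ⟨x, hx, hyx i hy⟩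
  have hlower : ∀ i, ∃ θ > 0, ∀ y ∈ K, ⟪y, n i⟫ = 0 →
      θ ≤ fderiv ℝ (fun y => ∑ x ∈ t, Ψ x y) y (dv i) := by
    intro i
    have hKi : IsCompact (K ∩ {y | ⟪y, n i⟫ = 0}) :=
      hK.inter_right (isClosed_eq (by fun_prop) continuous_const)
    obtain ⟨θ, hθ, h⟩ := hKi.exists_forall_le' (a := 0)
      (((hsmooth.continuous_fderiv (by norm_num)).clm_apply continuous_const).continuousOn)
      (fun y hy => hpos i y hy.1 hy.2)
    exact ⟨θ, hθ, fun y hyK hy => h y ⟨hyK, hy⟩⟩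
  choose θ hθ hθle using hlower
  obtain ⟨θ₀, hθ₀, hmin⟩ : ∃ θ₀ > 0, ∀ i, θ₀ ≤ θ i := by
    rcases isEmpty_or_nonempty (Fin I) with h | h
    · exact ⟨1, one_pos, fun i => h.elim i⟩
    · obtain ⟨j, hj⟩ := Finite.exists_min θ
      exact ⟨θ j, hθ j, hj⟩
  exact ⟨θ₀, hθ₀, fun i y hyK hy => (hmin i).trans (hθle i y hyK hy)⟩

end

section

variable {E : Type*} [NormedAddCommGroup E] [NormedSpace ℝ E]

/-- Induction on dyadic scales, from large vectors down to the origin. -/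
lemma dyadic_induction {R : ℝ} {P : E → Prop} (hout : ∀ x, R < ‖x‖ → P x)
    (hstep : ∀ x, x ≠ 0 → P ((2 : ℝ) • x) → P x) {x : E} (hx : x ≠ 0) : P x := by
  obtain ⟨k, hk⟩ : ∃ k : ℕ, R < 2 ^ k * ‖x‖ := by
    obtain ⟨k, hk⟩ := pow_unbounded_of_one_lt (R / ‖x‖) (one_lt_two (α := ℝ))
    exact ⟨k, (div_lt_iff₀ (norm_pos_iff.2 hx)).1 hk⟩
  induction k generalizing x with
  | zero => exact hout x (by simpa using hk)
  | succ k ih =>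
    refine hstep x hx (ih (smul_ne_zero two_ne_zero hx) ?_)
    rw [norm_smul, Real.norm_two]
    rwa [pow_succ, mul_assoc] at hk

/-- A function which is continuous away from the origin, vanishes at infinity, and does not
increase when the scale is halved near the origin, is bounded above. -/
lemma exists_upper_bound_of_dyadic [ProperSpace E] {F : E → ℝ} {r R : ℝ} (hr : 0 < r)
    (hF : ContinuousOn F {0}ᶜ) (hout : ∀ x, R < ‖x‖ → F x = 0)
    (hscale : ∀ x, x ≠ 0 → ‖x‖ < r → F x ≤ F ((2 : ℝ) • x)) :
    ∃ C, 0 ≤ C ∧ ∀ x, x ≠ 0 → F x ≤ C := by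
  have hK : IsCompact (Metric.closedBall (0 : E) R \ Metric.ball 0 r) :=
    (isCompact_closedBall 0 R).diff Metric.isOpen_ball
  obtain ⟨C, hC⟩ := hK.exists_bound_of_continuousOn (hF.mono fun x hx => by
    rintro rfl
    exact hx.2 (Metric.mem_ball_self hr))
  refine ⟨max C 0, le_max_right _ _, fun x hx => ?_⟩
  refine dyadic_induction (R := R) (P := fun x => F x ≤ max C 0)
    (fun x hx => (hout x hx).trans_le (le_max_right _ _)) (fun x hx h2 => ?_) hx
  rcases lt_or_ge ‖x‖ r with h | h
  · exact (hscale x hx h).trans h2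
  rcases lt_or_ge R ‖x‖ with h' | h'
  · exact (hout x h').trans_le (le_max_right _ _)
  · exact (le_abs_self _).trans ((hC x ⟨by simpa using h', by simpa using h⟩).trans
      (le_max_left _ _))

/-- The sum `∑ₘ 2⁻ᵐ ψ(2ᵐ x)`, characterised by its functional equation. -/
lemma exists_dyadic_sum {ψ : E → ℝ} {R : ℝ} (hψ0 : ψ 0 = 0) (hψR : ∀ x, R ≤ ‖x‖ → ψ x = 0) :
    ∃ g : E → ℝ, g 0 = 0 ∧ (∀ x, R ≤ ‖x‖ → g x = 0) ∧
      ∀ x, g x = ψ x + 2⁻¹ * g ((2 : ℝ) • x) := by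
  have hfin : ∀ x, Summable fun m : ℕ => (2⁻¹ : ℝ) ^ m * ψ ((2 : ℝ) ^ m • x) := by
    intro x
    by_cases hx : x = 0
    · simp [hx, hψ0]
    obtain ⟨N, hN⟩ := pow_unbounded_of_one_lt (R / ‖x‖) (one_lt_two (α := ℝ))
    refine summable_of_ne_finset_zero (s := Finset.range N) fun m hm => ?_
    rw [hψR, mul_zero]
    rw [div_lt_iff₀ (norm_pos_iff.2 hx)] at hN
    rw [norm_smul, norm_pow, Real.norm_two]
    refine hN.le.trans (mul_le_mul_of_nonneg_right ?_ (norm_nonneg x))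
    exact pow_le_pow_right₀ one_le_two (by simpa using hm)
  refine ⟨fun x => ∑' m : ℕ, (2⁻¹ : ℝ) ^ m * ψ ((2 : ℝ) ^ m • x), by simp [hψ0], fun x hx => ?_,
    fun x => ?_⟩
  · have : ∀ m : ℕ, (2⁻¹ : ℝ) ^ m * ψ ((2 : ℝ) ^ m • x) = 0 := by
      intro m
      rw [hψR, mul_zero]
      rw [norm_smul, norm_pow, Real.norm_two]
      exact hx.trans (le_mul_of_one_le_left (norm_nonneg x) (one_le_pow₀ one_le_two))
    simp only [this, tsum_zero]
  · beta_reduce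
    rw [(hfin x).tsum_eq_zero_add, ← tsum_mul_left]
    simp only [pow_zero, one_smul, one_mul, pow_succ, smul_smul, add_right_inj]
    exact tsum_congr fun m => by ring

end

section

variable {J : ℕ}

/-- Summing rescaled copies of an annular function gives a function whose gradient is bounded
and whose second derivatives are of order `1 / ‖x‖`. -/
lemma exists_dyadic_sum_bounds {ψ : EuclJ J → ℝ} {r R : ℝ} (hr : 0 < r) (hψ : ContDiff ℝ 2 ψ)
    (hψr : ∀ x, ‖x‖ ≤ r → ψ x = 0) (hψR : ∀ x, R ≤ ‖x‖ → ψ x = 0) :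
    ∃ (g : EuclJ J → ℝ) (L : ℝ), ContDiffOn ℝ 2 g {0}ᶜ ∧ (∀ x, R ≤ ‖x‖ → g x = 0) ∧
      (∀ x, x ≠ 0 → fderiv ℝ g x = fderiv ℝ ψ x + fderiv ℝ g ((2 : ℝ) • x)) ∧
      (∀ x, |g x| ≤ L) ∧ (∀ x, ‖fderiv ℝ g x‖ ≤ L) ∧
      ∀ x, x ≠ 0 → ∑ i : Fin J, ∑ j : Fin J,
        |fderiv ℝ (fun y => fderiv ℝ g y (EuclideanSpace.single i (1 : ℝ))) x
          (EuclideanSpace.single j (1 : ℝ))| ≤ 2 * L / ‖x‖ := by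
  obtain ⟨g, hg0, hgR, hg⟩ := exists_dyadic_sum (hψr 0 (by simpa using hr.le)) hψR
  have hgR' : ∀ x, R < ‖x‖ → g =ᶠ[nhds x] fun _ => 0 := fun x hx => by
    filter_upwards [(continuous_norm.continuousAt (x := x)).eventually (lt_mem_nhds hx)] with y hy
      using hgR y hy.le
  have hψr' : ∀ x, ‖x‖ < r → ψ =ᶠ[nhds x] fun _ => 0 := fun x hx => by
    filter_upwards [(continuous_norm.continuousAt (x := x)).eventually (gt_mem_nhds hx)] with y hy
      using hψr y hy.le
  have hsmooth : ∀ x, x ≠ 0 → ContDiffAt ℝ 2 g x := fun x hx =>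
    dyadic_induction (R := R) (P := ContDiffAt ℝ 2 g)
      (fun x hx => contDiffAt_const.congr_of_eventuallyEq (hgR' x hx))
      (fun x _ h => by
        have h2 : ContDiffAt ℝ 2 (fun y => ψ y + 2⁻¹ * g ((2 : ℝ) • y)) x :=
          hψ.contDiffAt.add (contDiffAt_const.mul (h.comp x (contDiffAt_id.const_smul (2 : ℝ))))
        exact h2.congr_of_eventuallyEq (Eventually.of_forall hg)) hx
  have hfd : ∀ x, x ≠ 0 → fderiv ℝ g x = fderiv ℝ ψ x + fderiv ℝ g ((2 : ℝ) • x) := by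
    intro x hx
    have hd2 : DifferentiableAt ℝ (fun y => g ((2 : ℝ) • y)) x :=
      ((hsmooth _ (smul_ne_zero two_ne_zero hx)).differentiableAt (by norm_num)).comp x
        (differentiableAt_id.const_smul (2 : ℝ))
    conv_lhs => rw [show g = fun y => ψ y + 2⁻¹ * g ((2 : ℝ) • y) from funext hg]
    rw [fderiv_fun_add (hψ.differentiable (by norm_num) x) (hd2.const_mul _),
      fderiv_const_mul hd2, fderiv_comp_smul, smul_smul, inv_mul_cancel₀ two_ne_zero, one_smul]
  have hfdr : ∀ x, x ≠ 0 → ‖x‖ < r → fderiv ℝ g x = fderiv ℝ g ((2 : ℝ) • x) := by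
    intro x hx hxr
    rw [hfd x hx, (hψr' x hxr).fderiv_eq]
    simp
  have hfdR : ∀ x, R < ‖x‖ → fderiv ℝ g x = 0 := fun x hx => by
    rw [(hgR' x hx).fderiv_eq]; simp
  set D : Fin J → EuclJ J → ℝ := fun i y => fderiv ℝ g y (EuclideanSpace.single i (1 : ℝ))
    with hD
  have hDsmooth : ∀ i x, x ≠ 0 → ContDiffAt ℝ 1 (D i) x := fun i x hx =>
    ((hsmooth x hx).fderiv_right (by norm_num)).clm_apply contDiffAt_const
  set S : EuclJ J → ℝ := fun x => ∑ i : Fin J, ∑ j : Fin J,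
    |fderiv ℝ (D i) x (EuclideanSpace.single j (1 : ℝ))| with hS
  obtain ⟨L₁, hL₁, hb₁⟩ := exists_upper_bound_of_dyadic (F := fun x => |g x|) (R := R) hr
    (fun x hx => (hsmooth x hx).continuousAt.abs.continuousWithinAt)
    (fun x hx => by simp [hgR x hx.le]) (fun x hx hxr => by
      rw [hg x, hψr x hxr.le, zero_add, abs_mul, abs_of_pos (by norm_num : (0 : ℝ) < 2⁻¹)]
      linarith [abs_nonneg (g ((2 : ℝ) • x))])
  obtain ⟨L₂, hL₂, hb₂⟩ := exists_upper_bound_of_dyadic (F := fun x => ‖fderiv ℝ g x‖) (R := R) hr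
    (fun x hx => ((hsmooth x hx).continuousAt_fderiv (by norm_num)).norm.continuousWithinAt)
    (fun x hx => by simp [hfdR x hx]) (fun x hx hxr => by rw [hfdr x hx hxr])
  obtain ⟨L₃, hL₃, hb₃⟩ := exists_upper_bound_of_dyadic (F := fun x => ‖x‖ * S x) (R := R) hr
    (fun x hx => (continuousAt_id.norm.mul (tendsto_finsetSum _ fun i _ => tendsto_finsetSum _
      fun j _ => (((hDsmooth i x hx).continuousAt_fderiv (by norm_num)).clm_apply
        continuousAt_const).abs)).continuousWithinAt)
    (fun x hx => by
      have : ∀ i, D i =ᶠ[nhds x] fun _ => 0 := fun i => by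
        filter_upwards [(continuous_norm.continuousAt (x := x)).eventually (lt_mem_nhds hx)]
          with y hy
        simp [hD, hfdR y hy]
      have hS0 : S x = 0 := Finset.sum_eq_zero fun i _ => Finset.sum_eq_zero fun j _ => by
        rw [(this i).fderiv_eq]; simp
      rw [hS0, mul_zero])
    (fun x hx hxr => by
      have : ∀ i, D i =ᶠ[nhds x] fun y => D i ((2 : ℝ) • y) := fun i => by
        filter_upwards [(continuous_norm.continuousAt (x := x)).eventually (gt_mem_nhds hxr),
          isOpen_ne.mem_nhds hx] with y hy hy0
        simp only [hD]
        rw [hfdr y hy0 hy]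
      have h2 : S x = 2 * S ((2 : ℝ) • x) := by
        simp only [hS, Finset.mul_sum]
        refine Finset.sum_congr rfl fun i _ => Finset.sum_congr rfl fun j _ => ?_
        rw [(this i).fderiv_eq, fderiv_comp_smul]
        simp [abs_mul]
      rw [h2, norm_smul, Real.norm_two]
      exact le_of_eq (by ring))
  have hL4 : 0 ≤ ‖fderiv ℝ g 0‖ := norm_nonneg _
  refine ⟨g, L₁ + L₂ + L₃ + ‖fderiv ℝ g 0‖, fun x hx => (hsmooth x hx).contDiffWithinAt, hgR, hfd,
    fun x => ?_, fun x => ?_, fun x hx => ?_⟩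
  · by_cases hx : x = 0
    · rw [hx, hg0, abs_zero]; positivity
    · linarith [hb₁ x hx]
  · by_cases hx : x = 0
    · rw [hx]; linarith
    · linarith [hb₂ x hx]
  · rw [le_div_iff₀ (norm_pos_iff.2 hx)]
    have := hb₃ x hx
    simp only [hS] at this
    linarith

end

lemma inner_gradient_eq_fderiv {J : ℕ} (g : EuclJ J → ℝ) (x w : EuclJ J) :
    ⟪gradient g x, w⟫ = fderiv ℝ g x w :=
  InnerProductSpace.toDual_symm_apply

lemma norm_gradient_eq_norm_fderiv {J : ℕ} (g : EuclJ J → ℝ) (x : EuclJ J) :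
    ‖gradient g x‖ = ‖fderiv ℝ g x‖ :=
  LinearIsometryEquiv.norm_map _ _

/-- For a conical polyhedral ESP (all `cᵢ = 0`) with angle less than `π`,
satisfying the set-B condition and with `V`-set `{0}`, for every `R > 0` there is a `C²`
test function `g` supported in `{|x| ≤ R}` satisfying the oblique derivative inequalities
on the boundary and whose second derivatives grow at most like `2L/|x|` (the test-function
assumption with exponent `β = 1`). -/
theorem poly_cone_test_function {J I : ℕ} (dv n : Fin I → EuclJ J)
    (hn : ∀ i, ‖n i‖ = 1) (hdn : ∀ i, ⟪dv i, n i⟫ = 1)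
    (hG : (interior (polyG n (0 : Fin I → ℝ))).Nonempty)
    (hB : SetBCondition dv n)
    (hV : Vset (polyG n (0 : Fin I → ℝ)) (polyDir dv n (0 : Fin I → ℝ)) = {0})
    (v : EuclJ J) (hv : ‖v‖ = 1) (ζ : ℝ) (hζ : 0 < ζ)
    (hangle : ∀ x ∈ polyG n (0 : Fin I → ℝ), x ≠ 0 → ζ * ‖x‖ < ⟪x, v⟫)
    (R : ℝ) (hR : 0 < R) :
    ∃ (L θ r : ℝ) (g : EuclJ J → ℝ) (U : Set (EuclJ J)),
      0 < θ ∧ 0 < r ∧ r < R ∧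
      IsOpen U ∧ polyG n (0 : Fin I → ℝ) \ {0} ⊆ U ∧ ContDiffOn ℝ 2 g U ∧
      (∀ x ∈ polyG n (0 : Fin I → ℝ), R < ‖x‖ → g x = 0) ∧
      (∀ x ∈ frontier (polyG n (0 : Fin I → ℝ)), x ≠ 0 →
        ∀ w ∈ polyDir dv n (0 : Fin I → ℝ) x, ‖w‖ = 1 → 0 ≤ ⟪gradient g x, w⟫) ∧
      (∀ x ∈ frontier (polyG n (0 : Fin I → ℝ)), x ≠ 0 → ‖x‖ ≤ r →
        ∀ w ∈ polyDir dv n (0 : Fin I → ℝ) x, ‖w‖ = 1 → θ ≤ ⟪gradient g x, w⟫) ∧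
      (∀ x ∈ polyG n (0 : Fin I → ℝ), |g x| ≤ L ∧ ‖gradient g x‖ ≤ L) ∧
      (∀ x ∈ polyG n (0 : Fin I → ℝ), x ≠ 0 →
        ∑ i : Fin J, ∑ j : Fin J,
          |fderiv ℝ (fun y => fderiv ℝ g y (EuclideanSpace.single i (1:ℝ))) x
            (EuclideanSpace.single j (1:ℝ))| ≤ 2 * L / ‖x‖) := by
  have hd0 : ∀ i, dv i ≠ 0 := fun i h => by simpa [h] using hdn i
  set G := polyG n (0 : Fin I → ℝ) with hGdef
  set K : Set (EuclJ J) := frontier G ∩ {x | R / 4 ≤ ‖x‖ ∧ ‖x‖ ≤ R / 2}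
  set O : Set (EuclJ J) := {x | R / 8 < ‖x‖ ∧ ‖x‖ < R}
  have hO : IsOpen O := (isOpen_lt continuous_const continuous_norm).inter
    (isOpen_lt continuous_norm continuous_const)
  have hK : IsCompact K := (isCompact_closedBall (0 : EuclJ J) (R / 2)).of_isClosed_subset
    (isClosed_frontier.inter ((isClosed_le continuous_const continuous_norm).inter
      (isClosed_le continuous_norm continuous_const)))
    (fun x hx => by simpa using hx.2.2)
  obtain ⟨χ, hχ, hχc, hχ0, hχpos, hχd⟩ := hB.exists_bump hn hdn
  obtain ⟨ψ, hψ, hψO, hψ0, θ, hθ, hψθ⟩ : ∃ ψ : EuclJ J → ℝ, ContDiff ℝ 2 ψ ∧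
      (∀ y ∉ O, ψ y = 0) ∧ (∀ i y, ⟪y, n i⟫ = 0 → 0 ≤ fderiv ℝ ψ y (dv i)) ∧
      ∃ θ > 0, ∀ i, ∀ y ∈ K, ⟪y, n i⟫ = 0 → θ ≤ fderiv ℝ ψ y (dv i) := by
    refine exists_test_function_of_compact hK fun x hx => ?_
    obtain ⟨hxG, hx1, hx2⟩ := hx
    have hx0 : x ≠ 0 := norm_pos_iff.1 (by linarith)
    obtain ⟨q, hq⟩ := exists_inner_pos_of_notMem_Vset hd0 hxG (by rw [hV]; exact hx0)
    have hxO : x ∈ O := ⟨by linarith, by linarith⟩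
    obtain ⟨s, hs, hball⟩ := Metric.mem_nhds_iff.1
      ((eventually_inner_eq_zero_imp n x).and (hO.mem_nhds hxO))
    obtain ⟨ψ, h1, h2, h3⟩ := exists_local_test_function hχ hχc hχ0 hχpos hχd hq hs
      fun y hy => (hball hy).1
    exact ⟨ψ, h1, fun y hy => h2 y fun h => hy (hball h).2, h3⟩
  obtain ⟨g, L, hg, hgR, hfd, hgL, hfdL, hgL2⟩ := exists_dyadic_sum_bounds (r := R / 8) (R := R)
    (by linarith) hψ (fun x hx => hψO x fun h => h.1.not_ge hx)
    (fun x hx => hψO x fun h => h.2.not_ge hx)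
  have hgR' : ∀ x, R < ‖x‖ → fderiv ℝ g x = 0 := fun x hx => by
    have : g =ᶠ[nhds x] fun _ => 0 := by
      filter_upwards [(continuous_norm.continuousAt (x := x)).eventually (lt_mem_nhds hx)]
        with y hy using hgR y hy.le
    rw [this.fderiv_eq]; simp
  have htwo : ∀ x i, ⟪x, n i⟫ = 0 → ⟪(2 : ℝ) • x, n i⟫ = 0 := fun x i h => by
    rw [real_inner_smul_left, h, mul_zero]
  have hnonneg : ∀ x, x ≠ 0 → ∀ i, ⟪x, n i⟫ = 0 → 0 ≤ fderiv ℝ g x (dv i) := fun x hx =>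
    dyadic_induction (R := R) (P := fun x => ∀ i, ⟪x, n i⟫ = 0 → 0 ≤ fderiv ℝ g x (dv i))
      (fun x hx i _ => by simp [hgR' x hx])
      (fun x hx h i hi => by
        rw [hfd x hx]
        exact add_nonneg (hψ0 i x hi) (h i (htwo x i hi))) hx
  have hGtwo : ∀ x ∈ frontier G, (2 : ℝ) • x ∈ frontier G := by
    have hG2 : (fun x : EuclJ J => (2 : ℝ) • x) ⁻¹' G = G := by
      ext x
      simp [hGdef, polyG, real_inner_smul_left]
    intro x hx
    have := (Homeomorph.smulOfNeZero (2 : ℝ) (two_ne_zero) (α := EuclJ J)).preimage_frontier G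
    change (fun x : EuclJ J => (2 : ℝ) • x) ⁻¹' frontier G =
      frontier ((fun x : EuclJ J => (2 : ℝ) • x) ⁻¹' G) at this
    rw [hG2] at this
    rwa [← this] at hx
  have hpos : ∀ x, x ≠ 0 → x ∈ frontier G → ‖x‖ ≤ R / 2 → ∀ i, ⟪x, n i⟫ = 0 →
      θ ≤ fderiv ℝ g x (dv i) := fun x hx =>
    dyadic_induction (R := R / 2) (P := fun x => x ∈ frontier G → ‖x‖ ≤ R / 2 →
        ∀ i, ⟪x, n i⟫ = 0 → θ ≤ fderiv ℝ g x (dv i))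
      (fun x hx _ hx' => absurd hx' hx.not_ge)
      (fun x hx h hxG hxR i hi => by
        rw [hfd x hx, add_apply]
        rcases le_or_gt (R / 4) ‖x‖ with hx4 | hx4
        · have h1 := hψθ i x ⟨hxG, hx4, hxR⟩ hi
          have h2 := hnonneg _ (smul_ne_zero (two_ne_zero (α := ℝ)) hx) i (htwo x i hi)
          linarith
        · have h1 := hψ0 i x hi
          have h2 := h (hGtwo x hxG) (by rw [norm_smul, Real.norm_two]; linarith) i (htwo x i hi)
          linarith) hx
  obtain ⟨M, hM0, hdM⟩ : ∃ M : ℝ, 0 ≤ M ∧ ∀ i, ‖dv i‖ ≤ M :=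
    ⟨∑ i, ‖dv i‖, Finset.sum_nonneg fun i _ => norm_nonneg _, fun i =>
      Finset.single_le_sum (f := fun i => ‖dv i‖) (fun j _ => norm_nonneg _) (Finset.mem_univ i)⟩
  refine ⟨L, θ / (M + 1), R / 2, g, {0}ᶜ, div_pos hθ (by linarith), by linarith, by linarith,
    isOpen_compl_singleton, fun x hx => hx.2, hg, fun x _ hx => hgR x hx.le, ?_, ?_,
    fun x _ => ⟨hgL x, by rw [norm_gradient_eq_norm_fderiv]; exact hfdL x⟩,
    fun x _ hx => hgL2 x hx⟩
  · rintro x hx hx0 w (⟨-, a, ha, haI, rfl⟩ | ⟨h, -⟩) -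
    · rw [inner_gradient_eq_fderiv, map_sum]
      refine Finset.sum_nonneg fun i _ => ?_
      rw [map_smul, smul_eq_mul]
      by_cases hi : i ∈ polyIdx n (0 : Fin I → ℝ) x
      · exact mul_nonneg (ha i) (hnonneg x hx0 i hi)
      · simp [haI i hi]
    · exact absurd hx h
  · rintro x hx hx0 hxR w (⟨-, a, ha, haI, rfl⟩ | ⟨h, -⟩) hw
    · rw [inner_gradient_eq_fderiv, map_sum]
      have h1 : ∑ i, a i * θ ≤ ∑ i, fderiv ℝ g x (a i • dv i) := by
        refine Finset.sum_le_sum fun i _ => ?_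
        rw [map_smul, smul_eq_mul]
        by_cases hi : i ∈ polyIdx n (0 : Fin I → ℝ) x
        · exact mul_le_mul_of_nonneg_left (hpos x hx0 hx hxR i hi) (ha i)
        · simp [haI i hi]
      have h2 : 1 ≤ (∑ i, a i) * (M + 1) := by
        rw [← hw, Finset.sum_mul]
        refine (norm_sum_le _ _).trans (Finset.sum_le_sum fun i _ => ?_)
        rw [norm_smul, Real.norm_of_nonneg (ha i)]
        exact mul_le_mul_of_nonneg_left (by linarith [hdM i]) (ha i)
      refine le_trans ?_ h1
      rw [← Finset.sum_mul, div_le_iff₀ (by positivity)]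
      nlinarith
    · exact absurd hx h
end
end

section
/- Let {(d_i, n_i, 0) : i ∈ I} be a polyhedral ESP (all c_i = 0, so G is a closed convex polyhedral cone with vertex at the origin) with V-set equal to {0}, whose domain has angle less than π in the sense that there exist a unit vector v and ζ > 0 with ζ|x| < ⟨x, v⟩ for every x ∈ G \ {0}. Let U = ∂G \ {0}; for C ⊆ I let F_C = {x ∈ ∂G : I(x) = C}, let P(U) = {I(x) : x ∈ U}, and for z ∈ F_C let r_z = dist(z, ∂G \ ⋃_{C' ⊆ C} F_{C'}). Suppose for each C ∈ P(U) we are given bounded convex sets Q_C^−, Q_C^+ ⊆ ℝ^J with 0 ∈ interior(Q_C^−) and Q_C^− ⊆ interior(Q_C^+) ⊆ Q_C^+ ⊆ {x : |x| < 1}. Then for every 0 < r < R < ∞ there exist a countable set S ⊆ U and scalars ρ_z ∈ (0, r_z) for z ∈ S such that, writing Q_z^− = z + ρ_z Q_{I(z)}^− and Q_z^+ = z + ρ_z Q_{I(z)}^+: (1) there is N < ∞ with #{z ∈ S : x ∈ Q_z^+} ≤ N for every x ∈ G; (2) there is ν ∈ (0,∞) such that x ∈ Q_z^+ implies |x| ≤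 ν ρ_z; (3) if x ∈ ∂G ∩ Q_z^+ then every unit vector in d(x) lies in d(z); (4) U ∩ {x : |x| ≤ r} ⊆ ⋃_{z∈S} Q_z^−; (5) ⋃_{z∈S} Q_z^+ ⊆ {x : |x| ≤ R}. -/
open Set MeasureTheory Filter
open scoped RealInnerProductSpace

noncomputable section

/-- The scaled translate `z + ρ • Q` of a set `Q`. -/
def scaledTranslate {J : ℕ} (z : EuclJ J) (ρ : ℝ) (Q : Set (EuclJ J)) : Set (EuclJ J) :=
  (fun w => z + ρ • w) '' Q

/-- `r_z`: the distance from `z` to the union of the facets whose index set is not contained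
in `I(z)` (with the convention that the distance to the empty set is `0`, which is
`Metric.infDist`'s convention). -/
noncomputable def facetDist {J I : ℕ} (n : Fin I → EuclJ J) (c : Fin I → ℝ) (z : EuclJ J) :
    ℝ :=
  Metric.infDist z {x ∈ frontier (polyG n c) | ¬ polyIdx n c x ⊆ polyIdx n c z}

section ConePolyhedron

variable {J I : ℕ} {n : Fin I → EuclJ J}

theorem smul_mem_polyG_zero_iff {t : ℝ} (ht : 0 < t) (x : EuclJ J) :
    t • x ∈ polyG n (0 : Fin I → ℝ) ↔ x ∈ polyG n (0 : Fin I → ℝ) := by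
  simp only [polyG, mem_iInter, mem_ofPred_eq, Pi.zero_apply, real_inner_smul_left]
  exact forall_congr' fun i => mul_nonneg_iff_of_pos_left ht

theorem smul_mem_frontier_polyG_zero_iff {t : ℝ} (ht : 0 < t) (x : EuclJ J) :
    t • x ∈ frontier (polyG n (0 : Fin I → ℝ)) ↔ x ∈ frontier (polyG n (0 : Fin I → ℝ)) := by
  have h := (Homeomorph.smulOfNeZero (α := EuclJ J) t ht.ne').preimage_frontier
    (polyG n (0 : Fin I → ℝ))
  have h' : (Homeomorph.smulOfNeZero (α := EuclJ J) t ht.ne') ⁻¹' polyG n (0 : Fin I → ℝ)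
      = polyG n (0 : Fin I → ℝ) := by
    ext y
    exact smul_mem_polyG_zero_iff ht y
  rw [h'] at h
  exact Set.ext_iff.mp h x

theorem polyIdx_zero_smul {t : ℝ} (ht : 0 < t) (x : EuclJ J) :
    polyIdx n (0 : Fin I → ℝ) (t • x) = polyIdx n (0 : Fin I → ℝ) x := by
  ext i
  simp [polyIdx, real_inner_smul_left, ht.ne']

open scoped Pointwise in
theorem facetDist_zero_smul {t : ℝ} (ht : 0 < t) (z : EuclJ J) :
    facetDist n (0 : Fin I → ℝ) (t • z) = t * facetDist n (0 : Fin I → ℝ) z := by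
  have h : {x ∈ frontier (polyG n (0 : Fin I → ℝ)) |
      ¬ polyIdx n (0 : Fin I → ℝ) x ⊆ polyIdx n (0 : Fin I → ℝ) (t • z)} =
      t • {x ∈ frontier (polyG n (0 : Fin I → ℝ)) |
        ¬ polyIdx n (0 : Fin I → ℝ) x ⊆ polyIdx n (0 : Fin I → ℝ) z} := by
    ext x
    rw [Set.mem_smul_set_iff_inv_smul_mem₀ ht.ne']
    simp only [mem_ofPred_eq, smul_mem_frontier_polyG_zero_iff (inv_pos.mpr ht),
      polyIdx_zero_smul (inv_pos.mpr ht), polyIdx_zero_smul ht]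
  rw [facetDist, facetDist, h, infDist_smul₀ ht.ne', Real.norm_of_nonneg ht.le]

theorem facetDist_le_dist {c : Fin I → ℝ} {x z : EuclJ J} (hx : x ∈ frontier (polyG n c))
    (h : ¬ polyIdx n c x ⊆ polyIdx n c z) : facetDist n c z ≤ dist z x :=
  Metric.infDist_le_dist_of_mem ⟨hx, h⟩

theorem facetDist_pos {c : Fin I → ℝ} {z : EuclJ J}
    (hne : {x ∈ frontier (polyG n c) | ¬ polyIdx n c x ⊆ polyIdx n c z}.Nonempty) :
    0 < facetDist n c z := by
  have hev : ∀ᶠ x in nhds z, polyIdx n c x ⊆ polyIdx n c z := by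
    have : ∀ i, ∀ᶠ x in nhds z, i ∈ polyIdx n c x → i ∈ polyIdx n c z := by
      intro i
      by_cases hi : ⟪z, n i⟫ = c i
      · exact Eventually.of_forall fun _ _ => hi
      · have hc : Continuous fun x : EuclJ J => ⟪x, n i⟫ := by fun_prop
        filter_upwards [hc.continuousAt.eventually_ne hi] with x hx hx'
        exact absurd hx' hx
    exact (eventually_all.mpr this).mono fun x hx i => hx i
  obtain ⟨ε, hε, hball⟩ := Metric.eventually_nhds_iff.mp hev
  refine hε.trans_le ((Metric.le_infDist hne).mpr fun y hy => ?_)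
  by_contra! hlt
  exact hy.2 (hball (by rwa [dist_comm]))

theorem polyDir_mono {dv : Fin I → EuclJ J} {c : Fin I → ℝ} {x z : EuclJ J}
    (hx : x ∈ frontier (polyG n c)) (hz : z ∈ frontier (polyG n c))
    (h : polyIdx n c x ⊆ polyIdx n c z) : polyDir dv n c x ⊆ polyDir dv n c z := by
  rintro w (⟨-, a, ha, ha', rfl⟩ | ⟨hx', -⟩)
  · exact Or.inl ⟨hz, a, ha, fun i hi => ha' i fun hi' => hi (h hi'), rfl⟩
  · exact absurd hx hx'

theorem not_univ_subset_polyIdx_zero {v : EuclJ J} {ζ : ℝ} (hζ : 0 < ζ)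
    (hangle : ∀ x ∈ polyG n (0 : Fin I → ℝ), x ≠ 0 → ζ * ‖x‖ < ⟪x, v⟫)
    {z : EuclJ J} (hz : z ≠ 0) : ¬ univ ⊆ polyIdx n (0 : Fin I → ℝ) z := by
  intro h
  have hi : ∀ i, ⟪z, n i⟫ = 0 := fun i => h (mem_univ i)
  have h₁ := hangle z (by simp [polyG, hi]) hz
  have h₂ := hangle (-z) (by simp [polyG, hi]) (neg_ne_zero.mpr hz)
  rw [norm_neg, inner_neg_left] at h₂
  have := mul_nonneg hζ.le (norm_nonneg z)
  linarith

end ConePolyhedron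

section ScaledTranslate

variable {J : ℕ}

theorem scaledTranslate_mem_nhds {z : EuclJ J} {ρ : ℝ} (hρ : 0 < ρ) {Q : Set (EuclJ J)}
    (hQ : (0 : EuclJ J) ∈ interior Q) : scaledTranslate z ρ Q ∈ nhds z := by
  have hc : ContinuousAt (fun x : EuclJ J => ρ⁻¹ • (x - z)) z := by fun_prop
  have hQ' : Q ∈ nhds (ρ⁻¹ • (z - z)) := by
    simpa using mem_interior_iff_mem_nhds.mp hQ
  filter_upwards [hc hQ'] with x hx
  exact ⟨_, hx, by simp [smul_smul, hρ.ne']⟩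

theorem smul_mem_scaledTranslate {z x : EuclJ J} {ρ : ℝ} {Q : Set (EuclJ J)} (t : ℝ)
    (hx : x ∈ scaledTranslate z ρ Q) : t • x ∈ scaledTranslate (t • z) (t * ρ) Q := by
  obtain ⟨w, hw, rfl⟩ := hx
  exact ⟨w, hw, by simp [smul_smul]⟩

theorem norm_sub_lt_of_mem_scaledTranslate {z x : EuclJ J} {ρ : ℝ} (hρ : 0 < ρ)
    {Q : Set (EuclJ J)} (hQ : Q ⊆ Metric.ball 0 1) (hx : x ∈ scaledTranslate z ρ Q) :
    ‖x - z‖ < ρ := by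
  obtain ⟨w, hw, rfl⟩ := hx
  have : ‖w‖ < 1 := by simpa using hQ hw
  simp only [add_sub_cancel_left, norm_smul, Real.norm_of_nonneg hρ.le]
  nlinarith

end ScaledTranslate

theorem encard_le_of_fst_close {E : Type*} (Z : Finset E) (A : Set (ℕ × E))
    (hAZ : ∀ p ∈ A, p.2 ∈ Z) {m : ℕ} (hA : ∀ p ∈ A, ∀ q ∈ A, p.1 ≤ q.1 + m) :
    A.encard ≤ (((2 * m + 1) * Z.card : ℕ) : ℕ∞) := by
  rcases A.eq_empty_or_nonempty with rfl | ⟨q, hq⟩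
  · simp
  have hsub : A ⊆ ↑(Finset.Icc (q.1 - m) (q.1 + m) ×ˢ Z) := by
    intro p hp
    have h₁ := hA p hp q hq
    have h₂ := hA q hq p hp
    simp only [Finset.coe_product, mem_prod, Finset.mem_coe, Finset.mem_Icc]
    exact ⟨⟨by omega, h₁⟩, hAZ p hp⟩
  refine (encard_le_encard hsub).trans ?_
  rw [encard_coe_eq_coe_finsetCard, Finset.card_product, Nat.card_Icc]
  exact_mod_cast Nat.mul_le_mul_right _ (by omega)

/-- Covering lemma for conical polyhedral ESPs with `V = {0}` and angle
less than `π`: given convex "shape" sets `Q_C^− ⊆ interior Q_C^+ ⊆ unit ball` for each facet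
index set `C` occurring on `U = ∂G \ {0}`, and `0 < r < R`, there are countably many centres
`z ∈ S ⊆ U` and radii `ρ_z ∈ (0, r_z)` whose scaled translates `Q_z^± = z + ρ_z Q_{I(z)}^±`
satisfy a bounded-overlap property, a comparability of `|x|` with `ρ_z` on `Q_z^+`, locality
of the directions of constraint, cover `U ∩ {|x| ≤ r}` by the `Q_z^−`, and are all contained
in `{|x| ≤ R}`. -/
theorem poly_cone_covering {J I : ℕ} (dv n : Fin I → EuclJ J)
    (hn : ∀ i, ‖n i‖ = 1) (hdn : ∀ i, ⟪dv i, n i⟫ = 1)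
    (hG : (interior (polyG n (0 : Fin I → ℝ))).Nonempty)
    (hV : Vset (polyG n (0 : Fin I → ℝ)) (polyDir dv n (0 : Fin I → ℝ)) = {0})
    (v : EuclJ J) (hv : ‖v‖ = 1) (ζ : ℝ) (hζ : 0 < ζ)
    (hangle : ∀ x ∈ polyG n (0 : Fin I → ℝ), x ≠ 0 → ζ * ‖x‖ < ⟪x, v⟫)
    (Qm Qp : Set (Fin I) → Set (EuclJ J))
    (hQ : ∀ C : Set (Fin I),
      (∃ x ∈ frontier (polyG n (0 : Fin I → ℝ)) \ {0}, polyIdx n (0 : Fin I → ℝ) x = C) →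
      Convex ℝ (Qm C) ∧ Convex ℝ (Qp C) ∧
      Bornology.IsBounded (Qm C) ∧ Bornology.IsBounded (Qp C) ∧
      (0 : EuclJ J) ∈ interior (Qm C) ∧ Qm C ⊆ interior (Qp C) ∧
      Qp C ⊆ Metric.ball (0 : EuclJ J) 1)
    (r R : ℝ) (hr : 0 < r) (hrR : r < R) :
    ∃ (S : Set (EuclJ J)) (ρ : EuclJ J → ℝ),
      S.Countable ∧ S ⊆ frontier (polyG n (0 : Fin I → ℝ)) \ {0} ∧
      (∀ z ∈ S, 0 < ρ z ∧ ρ z < facetDist n (0 : Fin I → ℝ) z) ∧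
      (∃ N : ℕ, ∀ x ∈ polyG n (0 : Fin I → ℝ),
        {z ∈ S | x ∈ scaledTranslate z (ρ z) (Qp (polyIdx n (0 : Fin I → ℝ) z))}.encard
          ≤ (N : ℕ∞)) ∧
      (∃ ν : ℝ, 0 < ν ∧ ∀ z ∈ S,
        ∀ x ∈ scaledTranslate z (ρ z) (Qp (polyIdx n (0 : Fin I → ℝ) z)), ‖x‖ ≤ ν * ρ z) ∧
      (∀ z ∈ S, ∀ x ∈ frontier (polyG n (0 : Fin I → ℝ)) ∩
          scaledTranslate z (ρ z) (Qp (polyIdx n (0 : Fin I → ℝ) z)),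
        ∀ w ∈ polyDir dv n (0 : Fin I → ℝ) x, ‖w‖ = 1 →
          w ∈ polyDir dv n (0 : Fin I → ℝ) z) ∧
      ((frontier (polyG n (0 : Fin I → ℝ)) \ {0}) ∩ Metric.closedBall 0 r ⊆
        ⋃ z ∈ S, scaledTranslate z (ρ z) (Qm (polyIdx n (0 : Fin I → ℝ) z))) ∧
      (⋃ z ∈ S, scaledTranslate z (ρ z) (Qp (polyIdx n (0 : Fin I → ℝ) z)) ⊆
        Metric.closedBall 0 R) := by
  set c : Fin I → ℝ := 0 with hc
  have h0 : (0 : EuclJ J) ∈ frontier (polyG n c) := by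
    have : (0 : EuclJ J) ∈ Vset (polyG n c) (polyDir dv n c) := by simp [hV]
    exact this.1
  have hI0 : polyIdx n c 0 = univ := by
    ext i
    simp [polyIdx, hc]
  have hfac0 : ∀ z : EuclJ J, z ≠ 0 → ¬ polyIdx n c 0 ⊆ polyIdx n c z := by
    intro z hz
    rw [hI0]
    exact not_univ_subset_polyIdx_zero hζ hangle hz
  have hpos : ∀ z : EuclJ J, z ≠ 0 → 0 < facetDist n c z := fun z hz =>
    facetDist_pos ⟨0, h0, hfac0 z hz⟩
  have hle : ∀ z : EuclJ J, z ≠ 0 → facetDist n c z ≤ ‖z‖ := fun z hz => by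
    simpa using facetDist_le_dist h0 (hfac0 z hz)
  obtain ⟨ε, hε, hε2, hεR⟩ : ∃ ε : ℝ, 0 < ε ∧ ε ≤ 1 / 2 ∧ ε * r ≤ R - r :=
    ⟨min (1 / 2) ((R - r) / r), lt_min (by norm_num) (div_pos (by linarith) hr),
      min_le_left _ _, (le_div_iff₀ hr).mp (min_le_right _ _)⟩
  have hQ' : ∀ z ∈ frontier (polyG n c), z ≠ 0 →
      (0 : EuclJ J) ∈ interior (Qm (polyIdx n c z)) ∧
        Qp (polyIdx n c z) ⊆ Metric.ball (0 : EuclJ J) 1 := by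
    intro z hz hz0
    obtain ⟨-, -, -, -, h₁, -, h₂⟩ := hQ _ ⟨z, ⟨hz, hz0⟩, rfl⟩
    exact ⟨h₁, h₂⟩
  -- the dyadic shell to be covered by finitely many sets
  let K : Set (EuclJ J) := frontier (polyG n c) ∩ {x | r / 2 ≤ ‖x‖ ∧ ‖x‖ ≤ r}
  have hKc : IsCompact K := by
    refine Metric.isCompact_of_isClosed_isBounded
      (isClosed_frontier.inter ((isClosed_le continuous_const continuous_norm).inter
        (isClosed_le continuous_norm continuous_const)))
      ((Metric.isBounded_closedBall (x := (0 : EuclJ J)) (r := r)).subset fun x hx => ?_)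
    simpa using hx.2.2
  have hK0 : ∀ z ∈ K, z ≠ 0 := by
    rintro z ⟨-, hz, -⟩ rfl
    rw [norm_zero] at hz
    linarith
  obtain ⟨Z, hZK, hZcov⟩ := hKc.elim_nhds_subcover
    (fun z => scaledTranslate z (ε * facetDist n c z) (Qm (polyIdx n c z)))
    fun z hz => scaledTranslate_mem_nhds (mul_pos hε (hpos z (hK0 z hz)))
      (hQ' z hz.1 (hK0 z hz)).1
  let g : ℕ × EuclJ J → EuclJ J := fun p => ((1 / 2 : ℝ) ^ p.1) • p.2
  let S : Set (EuclJ J) := g '' {p | p.2 ∈ Z}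
  have ht : ∀ k : ℕ, (0 : ℝ) < (1 / 2) ^ k := fun k => by positivity
  have hgU : ∀ p : ℕ × EuclJ J, p.2 ∈ Z → g p ∈ frontier (polyG n c) \ {0} := fun p hp =>
    ⟨(smul_mem_frontier_polyG_zero_iff (ht p.1) p.2).mpr (hZK _ hp).1,
      smul_ne_zero (ht p.1).ne' (hK0 _ (hZK _ hp))⟩
  have hSU : S ⊆ frontier (polyG n c) \ {0} := by
    rintro _ ⟨p, hp, rfl⟩
    exact hgU p hp
  have hnorm : ∀ p : ℕ × EuclJ J, ‖g p‖ = (1 / 2) ^ p.1 * ‖p.2‖ := fun p => by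
    simp [g, norm_smul]
  have hclose : ∀ z ∈ S, ∀ x ∈ scaledTranslate z (ε * facetDist n c z) (Qp (polyIdx n c z)),
      ‖x - z‖ < ε * facetDist n c z := fun z hz x hx =>
    norm_sub_lt_of_mem_scaledTranslate (mul_pos hε (hpos z (hSU hz).2))
      (hQ' z (hSU hz).1 (hSU hz).2).2 hx
  have hup : ∀ z ∈ S, ∀ x ∈ scaledTranslate z (ε * facetDist n c z) (Qp (polyIdx n c z)),
      ‖x‖ ≤ (1 + ε) * ‖z‖ ∧ ‖z‖ ≤ 2 * ‖x‖ := by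
    intro z hz x hx
    have h₁ := (hclose z hz x hx).le.trans
      (mul_le_mul_of_nonneg_left (hle z (hSU hz).2) hε.le)
    have h₂ := norm_le_norm_add_norm_sub' x z
    have h₃ := norm_le_norm_add_norm_sub x z
    have h₄ := mul_le_mul_of_nonneg_right hε2 (norm_nonneg z)
    constructor <;> linarith
  refine ⟨S, fun z => ε * facetDist n c z, ?_, hSU, ?_, ?_, ?_, ?_, ?_, ?_⟩
  · refine Set.Countable.image ?_ _
    have : {p : ℕ × EuclJ J | p.2 ∈ Z} = univ ×ˢ (Z : Set (EuclJ J)) := by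
      ext p
      simp
    rw [this]
    exact countable_univ.prod Z.countable_toSet
  · intro z hz
    have := hpos z (hSU hz).2
    exact ⟨mul_pos hε this, by nlinarith⟩
  · refine ⟨(2 * 3 + 1) * Z.card, fun x _ => ?_⟩
    let A : Set (ℕ × EuclJ J) := {p | p.2 ∈ Z ∧
      x ∈ scaledTranslate (g p) (ε * facetDist n c (g p)) (Qp (polyIdx n c (g p)))}
    have hsub : {z ∈ S | x ∈ scaledTranslate z (ε * facetDist n c z) (Qp (polyIdx n c z))} ⊆
        g '' A := by
      rintro _ ⟨⟨p, hp, rfl⟩, hx⟩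
      exact ⟨p, ⟨hp, hx⟩, rfl⟩
    refine (encard_le_encard hsub).trans ((encard_image_le _ _).trans
      (encard_le_of_fst_close Z A (fun p hp => hp.1) fun p hp q hq => ?_))
    have h₁ := (hup _ ⟨p, hp.1, rfl⟩ x hp.2).1
    have h₂ := (hup _ ⟨q, hq.1, rfl⟩ x hq.2).2
    rw [hnorm] at h₁ h₂
    have h₃ := mul_le_mul_of_nonneg_left (hZK _ hp.1).2.2 (ht p.1).le
    have h₄ := mul_le_mul_of_nonneg_left (hZK _ hq.1).2.1 (ht q.1).le
    have h₅ : (1 + ε) * ((1 / 2) ^ p.1 * ‖p.2‖) ≤ (3 / 2) * ((1 / 2) ^ p.1 * r) :=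
      mul_le_mul (by linarith) h₃ (mul_nonneg (ht _).le (norm_nonneg _)) (by norm_num)
    have h₆ : (1 / 2 : ℝ) ^ q.1 * r ≤ (6 * (1 / 2) ^ p.1) * r := by nlinarith
    have h₇ := le_of_mul_le_mul_right h₆ hr
    by_contra! hlt
    have h₈ : (1 / 2 : ℝ) ^ p.1 ≤ (1 / 2) ^ (q.1 + 3) :=
      pow_le_pow_of_le_one (by norm_num) (by norm_num) hlt.le
    rw [pow_add] at h₈
    norm_num at h₈
    linarith [ht q.1]
  · obtain ⟨M, hM⟩ : ∃ M : ℝ, ∀ z ∈ Z, ‖z‖ / facetDist n c z ≤ M := by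
      obtain ⟨M, hM⟩ := (Z.image fun z => ‖z‖ / facetDist n c z).bddAbove
      exact ⟨M, fun z hz => hM (by simpa using ⟨z, hz, rfl⟩)⟩
    refine ⟨2 * (|M| + 1) / ε, by positivity, ?_⟩
    rintro _ ⟨p, hp, rfl⟩ x hx
    have hp0 := hpos p.2 (hK0 _ (hZK _ hp))
    have h₁ : ‖p.2‖ ≤ (|M| + 1) * facetDist n c p.2 := by
      refine ((div_le_iff₀ hp0).mp (hM _ hp)).trans ?_
      exact mul_le_mul_of_nonneg_right (by linarith [le_abs_self M]) hp0.le
    have h₂ := (hup _ ⟨p, hp, rfl⟩ x hx).1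
    have h₃ : facetDist n c (g p) = (1 / 2) ^ p.1 * facetDist n c p.2 :=
      facetDist_zero_smul (ht p.1) p.2
    have h₄ : ‖g p‖ ≤ (|M| + 1) * facetDist n c (g p) := by
      rw [hnorm, h₃]
      calc (1 / 2) ^ p.1 * ‖p.2‖ ≤ (1 / 2) ^ p.1 * ((|M| + 1) * facetDist n c p.2) :=
            mul_le_mul_of_nonneg_left h₁ (ht _).le
        _ = _ := by ring
    have h₅ : 2 * (|M| + 1) / ε * (ε * facetDist n c (g p)) =
        2 * ((|M| + 1) * facetDist n c (g p)) := by
      field_simp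
    rw [h₅]
    nlinarith [norm_nonneg (g p)]
  · rintro z hz x ⟨hxf, hx⟩ w hw -
    have h₁ := hclose z hz x hx
    refine polyDir_mono hxf (hSU hz).1 ?_ hw
    by_contra hnot
    have h₂ := facetDist_le_dist hxf hnot
    rw [dist_comm, dist_eq_norm] at h₂
    nlinarith [hpos z (hSU hz).2]
  · rintro x ⟨⟨hxf, hx0⟩, hxr⟩
    have hxn : 0 < ‖x‖ := norm_pos_iff.mpr hx0
    have hxr' : ‖x‖ ≤ r := by simpa using hxr
    obtain ⟨k, hk₁, hk₂⟩ := exists_nat_pow_near_of_lt_one (x := ‖x‖ / r)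
      (y := (1 / 2 : ℝ)) (div_pos hxn hr) ((div_le_one hr).mpr hxr') (by norm_num) (by norm_num)
    rw [lt_div_iff₀ hr] at hk₁
    rw [div_le_iff₀ hr] at hk₂
    have hx' : ((1 / 2 : ℝ) ^ k)⁻¹ • x ∈ K := by
      refine ⟨(smul_mem_frontier_polyG_zero_iff (inv_pos.mpr (ht k)) x).mpr hxf, ?_⟩
      rw [mem_ofPred_eq, norm_smul, Real.norm_of_nonneg (inv_pos.mpr (ht k)).le,
        le_inv_mul_iff₀ (ht k), inv_mul_le_iff₀ (ht k)]
      rw [pow_succ] at hk₁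
      exact ⟨by linarith, hk₂⟩
    obtain ⟨z, hz, hxz⟩ := mem_iUnion₂.mp (hZcov hx')
    refine mem_iUnion₂.mpr ⟨g (k, z), ⟨(k, z), hz, rfl⟩, ?_⟩
    have h := smul_mem_scaledTranslate ((1 / 2 : ℝ) ^ k) hxz
    rw [smul_inv_smul₀ (ht k).ne'] at h
    have h₁ : facetDist n c (g (k, z)) = (1 / 2) ^ k * facetDist n c z :=
      facetDist_zero_smul (ht k) z
    have h₂ : polyIdx n c (g (k, z)) = polyIdx n c z := polyIdx_zero_smul (ht k) z
    beta_reduce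
    rw [h₁, h₂, mul_left_comm]
    exact h
  · refine iUnion₂_subset ?_
    rintro _ ⟨p, hp, rfl⟩ x hx
    have h₁ := (hup _ ⟨p, hp, rfl⟩ x hx).1
    have h₂ : ‖g p‖ ≤ r := by
      rw [hnorm]
      exact (mul_le_of_le_one_left (norm_nonneg _)
        (pow_le_one₀ (by norm_num) (by norm_num))).trans (hZK _ hp).2.2
    have h₃ := mul_le_mul_of_nonneg_left h₂ (by linarith : 0 ≤ 1 + ε)
    rw [mem_closedBall_zero_iff]
    linarith
end
end
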